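/- Let G be a finite simple graph, let a, b, m be integers with 1 ≤ a ≤ b and 0 ≤ m ≤ b, let S ⊆ V(G), let T = {x ∈ V(G)∖S : d_{G−S}(x) ≤ a−1}, and let H be any subgraph of G with exactly m edges. Then Σ_{x ∈ S} d_H(x) − e_H(T,S) + Θ(S,T,H) ≤ 2m, where Θ(S,T,H) = Σ over all vertices x ∈ T satisfying e_H(x,S) ≥ 2 and 1 ≤ d_{G∖E(H)−S}(x) − a + d_H(x) ≤ e_H(x,S) − 1 of the quantity d_{G∖E(H)−S}(x) − a + d_H(x). -/

import Mathlib

open Finset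

/-- A fractional `[a,b]`-factor of `G`: a function `h` on (potential) edges taking values
in `[0,1]` on edges of `G`, such that for every vertex `u` the total weight of edges of `G`
incident with `u` lies between `a` and `b`. -/
def SimpleGraph.IsFracFactor {V : Type*} [Fintype V] [DecidableEq V]
    (G : SimpleGraph V) [DecidableRel G.Adj] (a b : ℕ) (h : Sym2 V → ℝ) : Prop :=
  (∀ e ∈ G.edgeSet, 0 ≤ h e ∧ h e ≤ 1) ∧
  ∀ u : V, (a : ℝ) ≤ ∑ e ∈ G.incidenceFinset u, h e ∧
    ∑ e ∈ G.incidenceFinset u, h e ≤ (b : ℝ)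

/-- `G` is fractional `(a,b,m)`-covered: for every set `M` of `m` edges of `G` there is a
fractional `[a,b]`-factor `h` of `G` with `h e = 1` for all `e ∈ M`. -/
def SimpleGraph.IsFracABMCovered {V : Type*} [Fintype V] [DecidableEq V]
    (G : SimpleGraph V) [DecidableRel G.Adj] (a b m : ℕ) : Prop :=
  ∀ M : Finset (Sym2 V), ↑M ⊆ G.edgeSet → M.card = m →
    ∃ h : Sym2 V → ℝ, G.IsFracFactor a b h ∧ ∀ e ∈ M, h e = 1

variable {V : Type*} [Fintype V] [DecidableEq V]

/-- `d_{G-S}(x)`: the degree of `x` in the induced subgraph of `G` on `V(G) ∖ S`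
(for `x ∉ S` this is the number of neighbors of `x` outside of `S`). -/
def SimpleGraph.degOut (G : SimpleGraph V) [DecidableRel G.Adj] (S : Finset V) (x : V) : ℕ :=
  (G.neighborFinset x \ S).card

/-- `T = {x ∈ V(G) ∖ S : d_{G-S}(x) ≤ a - 1}`. -/
def SimpleGraph.Tset (G : SimpleGraph V) [DecidableRel G.Adj] (a : ℕ) (S : Finset V) :
    Finset V :=
  Finset.univ.filter fun x => x ∉ S ∧ G.degOut S x ≤ a - 1

/-- `d_H(x)`: the degree of `x` in the subgraph `H` given by its edge set `M`. -/
def degH (M : Finset (Sym2 V)) (x : V) : ℕ :=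
  (Finset.univ.filter fun y => s(x, y) ∈ M).card

/-- `e_H(x,S)`: the number of edges of `H` (with edge set `M`) joining `x` to a vertex of `S`. -/
def eHxS (M : Finset (Sym2 V)) (x : V) (S : Finset V) : ℕ :=
  (S.filter fun y => s(x, y) ∈ M).card

/-- `e_H(T,S)`: the number of edges of `H` (with edge set `M`) with one endpoint in `T`
and the other in `S`. -/
def eHTS (M : Finset (Sym2 V)) (T S : Finset V) : ℕ :=
  (M.filter fun e => ∃ x ∈ T, ∃ y ∈ S, e = s(x, y)).card

/-- `d_{G∖E(H)-S}(x)`: the degree of `x` in the graph obtained from `G` by deleting all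
edges of `H` (edge set `M`) and all vertices of `S`. -/
def SimpleGraph.degMinusH (G : SimpleGraph V) [DecidableRel G.Adj] (M : Finset (Sym2 V))
    (S : Finset V) (x : V) : ℕ :=
  ((G.neighborFinset x \ S).filter fun y => s(x, y) ∉ M).card

/-- `Θ(S,T,H)`: the sum over all `x ∈ T` with `e_H(x,S) ≥ 2` and
`1 ≤ d_{G∖E(H)-S}(x) - a + d_H(x) ≤ e_H(x,S) - 1` of `d_{G∖E(H)-S}(x) - a + d_H(x)`. -/
def SimpleGraph.theta (G : SimpleGraph V) [DecidableRel G.Adj] (a : ℕ)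
    (M : Finset (Sym2 V)) (S T : Finset V) : ℤ :=
  ∑ x ∈ T.filter (fun x => 2 ≤ eHxS M x S ∧
      1 ≤ (G.degMinusH M S x : ℤ) - (a : ℤ) + (degH M x : ℤ) ∧
      (G.degMinusH M S x : ℤ) - (a : ℤ) + (degH M x : ℤ) ≤ (eHxS M x S : ℤ) - 1),
    ((G.degMinusH M S x : ℤ) - (a : ℤ) + (degH M x : ℤ))

theorem sum_degH_le_two_mul_card (M : Finset (Sym2 V)) :
    ∑ x, degH M x ≤ 2 * M.card := by
  have hsum : ∑ x, degH M x =
      ((univ : Finset (V × V)).filter fun p => s(p.1, p.2) ∈ M).card := by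
    simp only [degH, card_filter, Fintype.sum_prod_type]
  rw [hsum]
  refine card_le_mul_card_image_of_maps_to (f := fun p : V × V => s(p.1, p.2))
    (fun p hp => (mem_filter.mp hp).2) 2 fun e _ => ?_
  induction e with
  | _ u v =>
    refine (card_le_card (t := {(u, v), (v, u)}) fun p hp => ?_).trans card_le_two
    simpa [Prod.ext_iff] using (mem_filter.mp hp).2

omit [Fintype V] in
theorem sum_eHxS_le_eHTS (M : Finset (Sym2 V)) {T S : Finset V} (hTS : Disjoint T S) :
    ∑ x ∈ T, eHxS M x S ≤ eHTS M T S := by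
  have hsum : ∑ x ∈ T, eHxS M x S =
      ((T ×ˢ S).filter fun p => s(p.1, p.2) ∈ M).card := by
    simp only [eHxS, card_filter, sum_product]
  rw [hsum]
  refine card_le_card_of_injOn (fun p => s(p.1, p.2)) (fun p hp => ?_) fun p hp q hq hpq => ?_
  · simp only [mem_coe, mem_filter, mem_product] at hp
    simp only [mem_coe, mem_filter]
    exact ⟨hp.2, p.1, hp.1.1, p.2, hp.1.2, rfl⟩
  · simp only [mem_coe, mem_filter, mem_product] at hp hq
    rcases Sym2.eq_iff.mp hpq with h | h
    · exact Prod.ext h.1 h.2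
    · exact absurd (h.1 ▸ hq.1.2) (Finset.disjoint_left.mp hTS hp.1.1)

theorem SimpleGraph.theta_le_sum_eHxS (G : SimpleGraph V) [DecidableRel G.Adj] (a : ℕ)
    (M : Finset (Sym2 V)) (S T : Finset V) :
    G.theta a M S T ≤ ∑ x ∈ T, (eHxS M x S : ℤ) := by
  refine (sum_le_sum fun x hx => ?_).trans
    (sum_le_sum_of_subset_of_nonneg (filter_subset _ _) fun x _ _ => Int.natCast_nonneg _)
  have := (mem_filter.mp hx).2.2.2
  lia

theorem SimpleGraph.disjoint_Tset (G : SimpleGraph V) [DecidableRel G.Adj] (a : ℕ)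
    (S : Finset V) : Disjoint (G.Tset a S) S :=
  Finset.disjoint_left.mpr fun _ hx => (mem_filter.mp hx).2.1

/-- for any `S ⊆ V(G)`, `T` as usual, and any subgraph `H` of `G` with exactly
`m` edges, `Σ_{x ∈ S} d_H(x) − e_H(T,S) + Θ(S,T,H) ≤ 2m`. -/
theorem theta_bound
    (G : SimpleGraph V) [DecidableRel G.Adj]
    (a b m : ℕ) (ha : 1 ≤ a) (hab : a ≤ b) (hmb : m ≤ b)
    (S : Finset V) (M : Finset (Sym2 V)) (hM : ↑M ⊆ G.edgeSet) (hMcard : M.card = m) :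
    (∑ x ∈ S, (degH M x : ℤ)) - (eHTS M (G.Tset a S) S : ℤ) +
        G.theta a M S (G.Tset a S) ≤ 2 * (m : ℤ) := by
  have hdeg : ∑ x ∈ S, (degH M x : ℤ) ≤ 2 * (m : ℤ) := by
    have h := (sum_le_univ_sum_of_nonneg (s := S) fun x => Nat.zero_le (degH M x)).trans
      (sum_degH_le_two_mul_card M)
    rw [hMcard] at h
    exact_mod_cast h
  have hcross : ∑ x ∈ G.Tset a S, (eHxS M x S : ℤ) ≤ (eHTS M (G.Tset a S) S : ℤ) := by
    exact_mod_cast sum_eHxS_le_eHTS M (G.disjoint_Tset a S)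
  have htheta := G.theta_le_sum_eHxS a M S (G.Tset a S)
  linarith
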